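/- Let q : ℤ² → ℝ be a finitely supported filter, let α ∈ ℕ² and let K ∈ ℕ with K > |α|. Suppose Σ_{k∈ℤ²} k^β q[k] = 0 for every β ∈ ℕ² with |β| < K and β ≠ α (i.e., q has sum rules of order α and total sum rules of order K∖{|α|+1}). Then for every infinitely differentiable function F : ℝ² → ℝ and every x ∈ ℝ², as ε → 0⁺ one has ε^{-|α|} · Σ_{k∈ℤ²} q[k] · F(x + εk) = C_α · (∂^{α₁+α₂} F / ∂x₁^{α₁} ∂x₂^{α₂})(x) + O(ε^{K-|α|}), where C_α = (1/(α₁!·α₂!)) · Σ_{k∈ℤ²} k₁^{α₁} k₂^{α₂} q[k]. -/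

import Mathlib

open Topology Asymptotics Finset

/-- Partial derivative with respect to the first variable. -/
noncomputable def pd1 (f : ℝ × ℝ → ℝ) : ℝ × ℝ → ℝ :=
  fun p => deriv (fun s => f (s, p.2)) p.1

/-- Partial derivative with respect to the second variable. -/
noncomputable def pd2 (f : ℝ × ℝ → ℝ) : ℝ × ℝ → ℝ :=
  fun p => deriv (fun s => f (p.1, s)) p.2

/-- The space of smooth real-valued functions on a normed space. -/
def smoothFunctions (E : Type*) [NormedAddCommGroup E] [NormedSpace ℝ E] :
    Submodule ℝ (E → ℝ) where
  carrier := {f | ContDiff ℝ (⊤ : ℕ∞) f}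
  add_mem' {f g} hf hg := by
    change ContDiff ℝ (⊤ : ℕ∞) f at hf
    change ContDiff ℝ (⊤ : ℕ∞) g at hg
    exact hf.add hg
  zero_mem' := by
    change ContDiff ℝ (⊤ : ℕ∞) fun _ : E => (0 : ℝ)
    exact contDiff_const
  smul_mem' c f hf := by
    change ContDiff ℝ (⊤ : ℕ∞) f at hf
    exact contDiff_const.smul hf

section DirDeriv

variable {E : Type*} [NormedAddCommGroup E] [NormedSpace ℝ E]

theorem mem_smoothFunctions {f : E → ℝ} :
    f ∈ smoothFunctions E ↔ ContDiff ℝ (⊤ : ℕ∞) f :=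
  Iff.rfl

theorem smoothFunctions.contDiff (f : smoothFunctions E) : ContDiff ℝ (⊤ : ℕ∞) (f : E → ℝ) :=
  mem_smoothFunctions.1 f.2

theorem smoothFunctions.differentiable (f : smoothFunctions E) :
    Differentiable ℝ (f : E → ℝ) :=
  (smoothFunctions.contDiff f).differentiable (by simp)

theorem smoothFunctions.contDiff_fderiv (f : smoothFunctions E) :
    ContDiff ℝ (⊤ : ℕ∞) (fderiv ℝ (f : E → ℝ)) :=
  (smoothFunctions.contDiff f).fderiv_right (by simp)

/-- The derivative in the direction `v`, as an endomorphism of the space of smooth functions. -/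
noncomputable def dirDeriv (v : E) : Module.End ℝ (smoothFunctions E) where
  toFun f := ⟨fun p => fderiv ℝ (f : E → ℝ) p v,
    mem_smoothFunctions.2 ((smoothFunctions.contDiff_fderiv f).clm_apply contDiff_const)⟩
  map_add' f g := by
    ext p
    simp [fderiv_add (smoothFunctions.differentiable f p) (smoothFunctions.differentiable g p)]
  map_smul' c f := by
    ext p
    simp [fderiv_const_smul (smoothFunctions.differentiable f p) c]

theorem dirDeriv_apply (v : E) (f : smoothFunctions E) (p : E) :
    (dirDeriv v f : E → ℝ) p = fderiv ℝ (f : E → ℝ) p v := rfl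

theorem dirDeriv_add_smul (a b : ℝ) (v w : E) :
    dirDeriv (a • v + b • w) = a • dirDeriv v + b • dirDeriv w := by
  ext f p
  simp [dirDeriv_apply]

theorem dirDeriv_commute (v w : E) : Commute (dirDeriv v) (dirDeriv w) := by
  have key (u u' : E) (f : smoothFunctions E) (p : E) :
      (dirDeriv u (dirDeriv u' f) : E → ℝ) p = fderiv ℝ (fderiv ℝ (f : E → ℝ)) p u u' := by
    change fderiv ℝ (fun y => fderiv ℝ (f : E → ℝ) y u') p u = _
    rw [fderiv_clm_apply ((smoothFunctions.contDiff_fderiv f).differentiable (by simp) p)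
      (differentiableAt_const u')]
    simp
  refine LinearMap.ext fun f => Subtype.ext (funext fun p => ?_)
  rw [Module.End.mul_apply, Module.End.mul_apply, key, key]
  exact ((smoothFunctions.contDiff f).contDiffAt.isSymmSndFDerivAt (n := (⊤ : ℕ∞)) (by
    rw [minSmoothness_of_isRCLikeNormedField]
    exact WithTop.coe_le_coe.2 (le_top (a := (2 : ℕ∞))))) v w

theorem iteratedDeriv_comp_line (f : smoothFunctions E) (x v : E) (n : ℕ) :
    iteratedDeriv n (fun t : ℝ => (f : E → ℝ) (x + t • v)) =
      fun t => ((dirDeriv v ^ n) f : E → ℝ) (x + t • v) := by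
  induction n with
  | zero => simp
  | succ n ih =>
    rw [iteratedDeriv_succ, ih]
    ext t
    have hline : HasDerivAt (fun t : ℝ => x + t • v) v t := by
      simpa using ((hasDerivAt_id t).smul_const v).const_add x
    rw [pow_succ', Module.End.mul_apply, dirDeriv_apply]
    exact ((smoothFunctions.differentiable ((dirDeriv v ^ n) f) _).hasFDerivAt.comp_hasDerivAt
      t hline).deriv

end DirDeriv

/-- Taylor expansion at the origin with an error term of order `K`. -/
theorem taylor_isBigO_nhdsGT_zero {g : ℝ → ℝ} (hg : ContDiff ℝ (⊤ : ℕ∞) g) {K : ℕ} (hK : K ≠ 0) :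
    (fun ε => g ε - ∑ n ∈ range K, ε ^ n / (n.factorial : ℝ) * iteratedDeriv n g 0)
      =O[𝓝[>] (0 : ℝ)] (fun ε => ε ^ K) := by
  obtain ⟨m, rfl⟩ := Nat.exists_eq_succ_of_ne_zero hK
  obtain ⟨C, hC⟩ := exists_taylor_mean_remainder_bound (n := m) (zero_le_one' ℝ)
    (hg.of_le (by exact_mod_cast le_top)).contDiffOn
  refine IsBigO.of_bound C ?_
  filter_upwards [Ioc_mem_nhdsGT (zero_lt_one' ℝ)] with ε hε
  have h := hC ε ⟨hε.1.le, hε.2⟩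
  rw [taylor_within_apply] at h
  rw [Real.norm_of_nonneg (pow_nonneg hε.1.le _)]
  simp only [sub_zero] at h
  refine le_of_eq_of_le (congrArg norm (congrArg (g ε - ·) (sum_congr rfl fun n _ => ?_))) h
  rw [iteratedDerivWithin_eq_iteratedDeriv (uniqueDiffOn_Icc zero_lt_one)
    (hg.of_le (by exact_mod_cast le_top)).contDiffAt (by simp), smul_eq_mul]
  ring

theorem pd1_eq_dirDeriv (f : smoothFunctions (ℝ × ℝ)) :
    pd1 f = dirDeriv ((1, 0) : ℝ × ℝ) f := by
  ext p
  exact ((smoothFunctions.differentiable f p).hasFDerivAt.comp_hasDerivAt p.1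
    ((hasDerivAt_id p.1).prodMk (hasDerivAt_const p.1 p.2))).deriv

theorem pd2_eq_dirDeriv (f : smoothFunctions (ℝ × ℝ)) :
    pd2 f = dirDeriv ((0, 1) : ℝ × ℝ) f := by
  ext p
  exact ((smoothFunctions.differentiable f p).hasFDerivAt.comp_hasDerivAt p.2
    ((hasDerivAt_const p.2 p.1).prodMk (hasDerivAt_id p.2))).deriv

theorem pd1_iterate_pd2_iterate_eq_dirDeriv (f : smoothFunctions (ℝ × ℝ)) (i j : ℕ) :
    pd1^[i] (pd2^[j] f) =
      (dirDeriv ((1, 0) : ℝ × ℝ) ^ i) ((dirDeriv ((0, 1) : ℝ × ℝ) ^ j) f) := by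
  rw [Module.End.pow_apply, Module.End.pow_apply]
  have h1 : Function.Semiconj ((↑) : smoothFunctions (ℝ × ℝ) → ℝ × ℝ → ℝ)
    (dirDeriv ((1, 0) : ℝ × ℝ)) pd1 := fun f => (pd1_eq_dirDeriv f).symm
  have h2 : Function.Semiconj ((↑) : smoothFunctions (ℝ × ℝ) → ℝ × ℝ → ℝ)
    (dirDeriv ((0, 1) : ℝ × ℝ)) pd2 := fun f => (pd2_eq_dirDeriv f).symm
  rw [(h1.iterate_right i).eq, (h2.iterate_right j).eq]

theorem dirDeriv_pow_eq_sum_antidiagonal (f : smoothFunctions (ℝ × ℝ)) (a b : ℝ) (n : ℕ)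
    (x : ℝ × ℝ) :
    ((dirDeriv (a, b) ^ n) f : ℝ × ℝ → ℝ) x =
      ∑ β ∈ antidiagonal n,
        (n.choose β.1 : ℝ) * (a ^ β.1 * b ^ β.2) * (pd1^[β.1] (pd2^[β.2] f)) x := by
  have hab : ((a, b) : ℝ × ℝ) = a • (1, 0) + b • (0, 1) := by simp
  rw [hab, dirDeriv_add_smul,
    (((dirDeriv_commute _ _).smul_left a).smul_right b).add_pow' n, LinearMap.sum_apply,
    Submodule.coe_sum, Finset.sum_apply]
  refine sum_congr rfl fun β _ => ?_
  rw [pd1_iterate_pd2_iterate_eq_dirDeriv, smul_pow, smul_pow]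
  simp
  ring

theorem taylor_pd_isBigO {F : ℝ × ℝ → ℝ} (hF : ContDiff ℝ (⊤ : ℕ∞) F) (x : ℝ × ℝ) (a b : ℝ)
    {K : ℕ} (hK : K ≠ 0) :
    (fun ε : ℝ => F (x.1 + ε * a, x.2 + ε * b) -
        ∑ n ∈ range K, ∑ β ∈ antidiagonal n,
          ε ^ n / ((β.1.factorial : ℝ) * (β.2.factorial : ℝ)) * (a ^ β.1 * b ^ β.2) *
            (pd1^[β.1] (pd2^[β.2] F)) x)
      =O[𝓝[>] (0 : ℝ)] (fun ε => ε ^ K) := by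
  let f : smoothFunctions (ℝ × ℝ) := ⟨F, mem_smoothFunctions.2 hF⟩
  have hg : ContDiff ℝ (⊤ : ℕ∞) (fun t : ℝ => F (x + t • (a, b))) :=
    hF.comp (contDiff_const.add (contDiff_id.smul contDiff_const))
  refine (taylor_isBigO_nhdsGT_zero hg hK).congr_left fun ε => ?_
  congr 1
  refine sum_congr rfl fun n _ => ?_
  rw [iteratedDeriv_comp_line f x (a, b) n]
  beta_reduce
  rw [zero_smul, add_zero, dirDeriv_pow_eq_sum_antidiagonal, mul_sum]
  refine sum_congr rfl fun β hβ => ?_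
  rw [HasAntidiagonal.mem_antidiagonal] at hβ
  subst hβ
  have hchoose : ((β.1 + β.2).choose β.1 : ℝ) * (β.1.factorial * β.2.factorial) =
      (β.1 + β.2).factorial := by
    rw [Nat.choose_symm_add, ← mul_assoc]
    exact_mod_cast Nat.add_choose_mul_factorial_mul_factorial β.1 β.2
  have h0 : ((β.1 + β.2).choose β.1 : ℝ) ≠ 0 := by
    exact_mod_cast (Nat.choose_pos (Nat.le_add_right _ _)).ne'
  rw [← hchoose]
  have h1 : (β.1.factorial : ℝ) ≠ 0 := by positivity
  have h2 : (β.2.factorial : ℝ) ≠ 0 := by positivity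
  field_simp
  rfl

/-- If a finitely supported filter `q : ℤ² → ℝ` satisfies `∑_k k^β q[k] = 0` for all
`β` with `|β| < K`, `β ≠ α` (sum rules of order `α` and total sum rules of order
`K∖{|α|+1}`, `K > |α|`), then for every smooth `F : ℝ² → ℝ` and every `x`, as `ε → 0⁺`,
`ε^{-|α|} ∑_k q[k] F(x + εk) = C_α ∂^α F(x) + O(ε^{K-|α|})` where
`C_α = (1/(α₁!α₂!)) ∑_k k₁^{α₁} k₂^{α₂} q[k]`. -/
theorem total_sum_rules_filter_high_order_approximation
    (q : (ℤ × ℤ) →₀ ℝ) (α : ℕ × ℕ) (K : ℕ) (hK : α.1 + α.2 < K)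
    (hsum : ∀ β : ℕ × ℕ, β.1 + β.2 < K → β ≠ α →
      ∑ k ∈ q.support, ((k.1 : ℝ) ^ β.1 * (k.2 : ℝ) ^ β.2) * q k = 0)
    (F : ℝ × ℝ → ℝ) (hF : ContDiff ℝ (⊤ : ℕ∞) F) (x : ℝ × ℝ) :
    (fun ε : ℝ =>
      (∑ k ∈ q.support, q k * F (x.1 + ε * (k.1 : ℝ), x.2 + ε * (k.2 : ℝ))) / ε ^ (α.1 + α.2)
        - ((1 / ((α.1.factorial : ℝ) * (α.2.factorial : ℝ))) *
            ∑ k ∈ q.support, ((k.1 : ℝ) ^ α.1 * (k.2 : ℝ) ^ α.2) * q k) *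
          (pd1^[α.1] (pd2^[α.2] F)) x)
    =O[𝓝[>] (0 : ℝ)] (fun ε => ε ^ (K - (α.1 + α.2))) := by
  have hK0 : K ≠ 0 := by omega
  have hO := IsBigO.sum (s := q.support) fun k _ =>
    (taylor_pd_isBigO hF x (k.1 : ℝ) (k.2 : ℝ) hK0).const_mul_left (q k)
  refine (hO.mul (isBigO_refl (fun ε : ℝ => (ε ^ (α.1 + α.2))⁻¹) _)).congr' ?_ ?_
  · filter_upwards [self_mem_nhdsWithin] with ε (hε : 0 < ε)
    have hmain : ∑ k ∈ q.support, q k * ∑ n ∈ range K, ∑ β ∈ antidiagonal n,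
          ε ^ n / ((β.1.factorial : ℝ) * (β.2.factorial : ℝ)) *
            ((k.1 : ℝ) ^ β.1 * (k.2 : ℝ) ^ β.2) * (pd1^[β.1] (pd2^[β.2] F)) x =
        ε ^ (α.1 + α.2) * (((1 / ((α.1.factorial : ℝ) * (α.2.factorial : ℝ))) *
            ∑ k ∈ q.support, ((k.1 : ℝ) ^ α.1 * (k.2 : ℝ) ^ α.2) * q k) *
          (pd1^[α.1] (pd2^[α.2] F)) x) := by
      have hswap : ∑ k ∈ q.support, q k * ∑ n ∈ range K, ∑ β ∈ antidiagonal n,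
            ε ^ n / ((β.1.factorial : ℝ) * (β.2.factorial : ℝ)) *
              ((k.1 : ℝ) ^ β.1 * (k.2 : ℝ) ^ β.2) * (pd1^[β.1] (pd2^[β.2] F)) x =
          ∑ n ∈ range K, ∑ β ∈ antidiagonal n,
            ε ^ n / ((β.1.factorial : ℝ) * (β.2.factorial : ℝ)) *
              (∑ k ∈ q.support, ((k.1 : ℝ) ^ β.1 * (k.2 : ℝ) ^ β.2) * q k) *
              (pd1^[β.1] (pd2^[β.2] F)) x := by
        simp_rw [mul_sum, sum_mul]
        rw [sum_comm]
        refine sum_congr rfl fun n _ => ?_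
        rw [sum_comm]
        exact sum_congr rfl fun β _ => sum_congr rfl fun k _ => by ring
      rw [hswap, sum_eq_single_of_mem (α.1 + α.2) (mem_range.2 hK),
        sum_eq_single_of_mem α (HasAntidiagonal.mem_antidiagonal.2 rfl)]
      · ring
      · intro β hβ hne
        rw [hsum β (by rw [HasAntidiagonal.mem_antidiagonal.1 hβ]; exact hK) hne,
          mul_zero, zero_mul]
      · intro n hn hne
        refine sum_eq_zero fun β hβ => ?_
        rw [HasAntidiagonal.mem_antidiagonal] at hβ
        rw [hsum β (by rw [hβ]; exact mem_range.1 hn) (by rintro rfl; exact hne hβ.symm),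
          mul_zero, zero_mul]
    rw [Finset.sum_apply]
    simp_rw [mul_sub]
    rw [sum_sub_distrib, hmain]
    field_simp
  · filter_upwards [self_mem_nhdsWithin] with ε (hε : 0 < ε)
    rw [← div_eq_mul_inv, pow_sub₀ _ hε.ne' hK.le, div_eq_mul_inv]
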